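/- Quantitative deformation lemma: let X be a Banach space, φ ∈ C¹(X,ℝ), S ⊂ X, c ∈ ℝ, ε, δ > 0 with ‖φ'(u)‖ ≥ 8ε/δ for all u ∈ φ^{−1}([c−2ε, c+2ε]) ∩ S_{2δ}. Then there exists η ∈ C([0,1]×X, X) with: η(0,·) = id; η(t,u) = u for u outside φ^{−1}([c−2ε,c+2ε]) ∩ S_{2δ}; η(1, φ^{c+ε} ∩ S) ⊂ φ^{c−ε}; η(t,·) is a homeomorphism for each t; ‖η(t,u) − u‖ ≤ δ; t ↦ φ(η(t,u)) is non-increasing; and φ(η(t,u)) < c for u ∈ φ^c ∩ S_δ, t ∈ (0,1]. -/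

import Mathlib

open Metric Set Filter

open Topology NNReal in
theorem ode_uniq {X : Type*} [NormedAddCommGroup X] [NormedSpace ℝ X] {f : X → X}
    (hf : LocallyLipschitz f) {γ₁ γ₂ : ℝ → X} {a b t₀ : ℝ} (ht₀ : t₀ ∈ Ioo a b)
    (h1 : ∀ t ∈ Ioo a b, HasDerivAt γ₁ (f (γ₁ t)) t)
    (h2 : ∀ t ∈ Ioo a b, HasDerivAt γ₂ (f (γ₂ t)) t) (h0 : γ₁ t₀ = γ₂ t₀) :
    EqOn γ₁ γ₂ (Ioo a b) := by
  have key : Ioo a b ⊆ {t | t ∈ Ioo a b ∧ γ₁ t = γ₂ t} := by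
    apply isPreconnected_Ioo.subset_of_closure_inter_subset
    · rw [isOpen_iff_mem_nhds]
      rintro t ⟨ht, hte⟩
      obtain ⟨K, s, hs, hK⟩ := hf (γ₁ t)
      have hI : ∀ᶠ t' in 𝓝 t, t' ∈ Ioo a b := isOpen_Ioo.mem_nhds ht
      have e1 : ∀ᶠ t' in 𝓝 t, γ₁ t' ∈ s := (h1 t ht).continuousAt hs
      have e2 : ∀ᶠ t' in 𝓝 t, γ₂ t' ∈ s := (h2 t ht).continuousAt (hte ▸ hs)
      have := ODE_solution_unique_of_eventually (v := fun _ => f) (s := fun _ => s) (K := K)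
        (f := γ₁) (g := γ₂) (t₀ := t)
        (Eventually.of_forall fun _ => hK)
        (by filter_upwards [hI, e1] with t' a b using ⟨h1 t' a, b⟩)
        (by filter_upwards [hI, e2] with t' a b using ⟨h2 t' a, b⟩) hte
      filter_upwards [hI, this] with t' a b using ⟨a, b⟩
    · exact ⟨t₀, ht₀, ht₀, h0⟩
    · rintro t ⟨hc, ht⟩
      refine ⟨ht, ?_⟩
      have : (𝓝[{t | t ∈ Ioo a b ∧ γ₁ t = γ₂ t}] t).NeBot := mem_closure_iff_nhdsWithin_neBot.1 hc
      refine tendsto_nhds_unique (f := γ₁) (l := 𝓝[{t | t ∈ Ioo a b ∧ γ₁ t = γ₂ t}] t)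
        ((h1 t ht).continuousAt.tendsto.mono_left nhdsWithin_le_nhds) ?_
      refine ((h2 t ht).continuousAt.tendsto.mono_left nhdsWithin_le_nhds).congr' ?_
      filter_upwards [self_mem_nhdsWithin] with t' h using h.2.symm
  exact fun t ht => (key ht).2

open Topology NNReal in
theorem ode_glue {X : Type*} [NormedAddCommGroup X] [NormedSpace ℝ X] {f : X → X}
    (hf : LocallyLipschitz f) {γ₁ γ₂ : ℝ → X} {a b c d t₀ : ℝ} (ht₁ : t₀ ∈ Ioo a b)
    (ht₂ : t₀ ∈ Ioo c d) (hac : a ≤ c)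
    (h1 : ∀ t ∈ Ioo a b, HasDerivAt γ₁ (f (γ₁ t)) t)
    (h2 : ∀ t ∈ Ioo c d, HasDerivAt γ₂ (f (γ₂ t)) t) (h0 : γ₁ t₀ = γ₂ t₀) :
    ∃ γ : ℝ → X, EqOn γ γ₁ (Ioo a b) ∧ ∀ t ∈ Ioo a d, HasDerivAt γ (f (γ t)) t := by
  rcases le_or_gt d b with hdb | hbd
  · exact ⟨γ₁, fun _ _ => rfl, fun t ht => h1 t ⟨ht.1, ht.2.trans_le hdb⟩⟩
  have hE : EqOn γ₁ γ₂ (Ioo c b) := ode_uniq hf ⟨ht₂.1, ht₁.2⟩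
    (fun t ht => h1 t ⟨hac.trans_lt ht.1, ht.2⟩) (fun t ht => h2 t ⟨ht.1, ht.2.trans hbd⟩) h0
  refine ⟨fun t => if t < b then γ₁ t else γ₂ t, fun t ht => if_pos ht.2, fun t ht => ?_⟩
  by_cases h : t < b
  · have e : (fun t => if t < b then γ₁ t else γ₂ t) =ᶠ[𝓝 t] γ₁ := by
      filter_upwards [Iio_mem_nhds h] with t' h' using if_pos h'
    have := (h1 t ⟨ht.1, h⟩).congr_of_eventuallyEq e
    simpa [h] using this
  · have hcb : c < b := ht₂.1.trans ht₁.2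
    have hct : c < t := hcb.trans_le (not_lt.1 h)
    have e : (fun t => if t < b then γ₁ t else γ₂ t) =ᶠ[𝓝 t] γ₂ := by
      filter_upwards [Ioi_mem_nhds hct] with t' h'
      by_cases hb : t' < b
      · simp [hb, hE ⟨h', hb⟩]
      · simp [hb]
    have := (h2 t ⟨hct, ht.2⟩).congr_of_eventuallyEq e
    simpa [h] using this

/-- Uniform local flow box. -/
theorem ode_box {X : Type*} [NormedAddCommGroup X] [NormedSpace ℝ X] [CompleteSpace X] {f : X → X}
    (hf : LocallyLipschitz f) {M : ℝ} (hM : ∀ x, ‖f x‖ ≤ M) (p : X) :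
    ∃ r > 0, ∃ e > 0, ∃ α : X → ℝ → X, (∀ x ∈ closedBall p r, α x 0 = x ∧
      ∀ t ∈ Ioo (-e) e, HasDerivAt (α x) (f (α x t)) t) ∧
      ∀ t ∈ Ioo (-e) e, ContinuousOn (fun x => α x t) (closedBall p r) := by
  obtain ⟨K, s, hs, hK⟩ := hf p
  obtain ⟨a, ha, has⟩ := Metric.nhds_basis_closedBall.mem_iff.1 hs
  have hM0 : 0 ≤ M := (norm_nonneg _).trans (hM p)
  set e : ℝ := a / 2 / (M + 1) with he
  have he0 : 0 < e := by positivity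
  have hMe : M * e ≤ a / 2 := by
    rw [he, mul_div_assoc', div_le_iff₀ (by positivity)]
    nlinarith
  have hpl : IsPicardLindelof (fun _ => f) (tmin := -e) (tmax := e) ⟨0, by constructor <;> linarith⟩
      p ⟨a, ha.le⟩ ⟨a / 2, by positivity⟩ ⟨M, hM0⟩ K := by
    apply IsPicardLindelof.of_time_independent
    · intro x _; exact hM x
    · exact hK.mono has
    · simp only [sub_zero, zero_sub, neg_neg, max_self]
      change M * e ≤ a - a / 2
      linarith
  obtain ⟨α, hα, L', hL⟩ := hpl.exists_forall_mem_closedBall_eq_hasDerivWithinAt_lipschitzOnWith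
  refine ⟨a / 2, by positivity, e, he0, α, fun x hx => ⟨(hα x hx).1, fun t ht => ?_⟩, fun t ht => ?_⟩
  · exact ((hα x hx).2 t (Ioo_subset_Icc_self ht)).hasDerivAt (Icc_mem_nhds ht.1 ht.2)
  · exact (hL t (Ioo_subset_Icc_self ht)).continuousOn

open Topology in
/-- solutions on all smaller intervals give a solution on the full interval -/
theorem ode_limit {X : Type*} [NormedAddCommGroup X] [NormedSpace ℝ X] {f : X → X}
    (hf : LocallyLipschitz f) {x : X} {A B : ℝ}
    (h : ∀ t ∈ Ioo A B, ∃ γ : ℝ → X, ∃ a b : ℝ, a < 0 ∧ 0 < b ∧ t ∈ Ioo a b ∧ γ 0 = x ∧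
      ∀ t ∈ Ioo a b, HasDerivAt γ (f (γ t)) t) (h0 : (0:ℝ) ∈ Ioo A B) :
    ∃ γ : ℝ → X, γ 0 = x ∧ ∀ t ∈ Ioo A B, HasDerivAt γ (f (γ t)) t := by
  choose! γ a b ha hb hab hx hγ using h
  refine ⟨fun t => γ t t, hx 0 h0, fun t ht => ?_⟩
  have e : (fun t => γ t t) =ᶠ[𝓝 t] γ t := by
    filter_upwards [isOpen_Ioo.mem_nhds ht, isOpen_Ioo.mem_nhds (hab t ht)] with s hs hs'
    have := ode_uniq hf (γ₁ := γ s) (γ₂ := γ t) (a := max (a s) (a t)) (b := min (b s) (b t))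
      (t₀ := 0) ⟨max_lt (ha s hs) (ha t ht), lt_min (hb s hs) (hb t ht)⟩
      (fun u hu => hγ s hs u ⟨(le_max_left _ _).trans_lt hu.1, hu.2.trans_le (min_le_left _ _)⟩)
      (fun u hu => hγ t ht u ⟨(le_max_right _ _).trans_lt hu.1, hu.2.trans_le (min_le_right _ _)⟩)
      ((hx s hs).trans (hx t ht).symm)
    have hss := hab s hs
    exact this ⟨max_lt hss.1 hs'.1, lt_min hss.2 hs'.2⟩
  exact (hγ t ht t (hab t ht)).congr_of_eventuallyEq e

open Topology in
theorem ode_forward {X : Type*} [NormedAddCommGroup X] [NormedSpace ℝ X] [CompleteSpace X] {f : X → X}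
    (hf : LocallyLipschitz f) {M : ℝ} (hM : ∀ x, ‖f x‖ ≤ M) (x : X) :
    ∃ a < 0, ∀ T > 0, ∃ γ : ℝ → X, γ 0 = x ∧ ∀ t ∈ Ioo a T, HasDerivAt γ (f (γ t)) t := by
  obtain ⟨r, hr, e, he, α, hα, -⟩ := ode_box hf hM x
  refine ⟨-e, by linarith, ?_⟩
  by_contra! hcon
  obtain ⟨T, hT, hno⟩ := hcon
  let R : Set ℝ := {b | ∃ γ : ℝ → X, γ 0 = x ∧ ∀ t ∈ Ioo (-e) b, HasDerivAt γ (f (γ t)) t}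
  have heR : e ∈ R := ⟨α x, (hα x (mem_closedBall_self hr.le)).1, (hα x (mem_closedBall_self hr.le)).2⟩
  have hTR : T ∈ upperBounds R := by
    rintro b ⟨γ, h0, hγ⟩
    by_contra! hb
    obtain ⟨t, ht, hn⟩ := hno γ h0
    exact hn (hγ t ⟨ht.1, ht.2.trans hb⟩)
  set s := sSup R with hs
  have hes : e ≤ s := le_csSup ⟨T, hTR⟩ heR
  obtain ⟨γ, h0, hγ⟩ := ode_limit hf (x := x) (A := -e) (B := s) (by
    intro t ht
    obtain ⟨b, ⟨γ, h0, hγ⟩, hb⟩ := exists_lt_of_lt_csSup ⟨e, heR⟩ (max_lt ht.2 (he.trans_le hes))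
    exact ⟨γ, -e, b, by linarith, (le_max_right _ _).trans_lt hb,
      ⟨ht.1, (le_max_left _ _).trans_lt hb⟩, h0, hγ⟩) ⟨by linarith, by linarith⟩
  have hM0 : 0 ≤ M := (norm_nonneg _).trans (hM x)
  have hLip : LipschitzOnWith ⟨M, hM0⟩ γ (Ioo (-e) s) :=
    (convex_Ioo _ _).lipschitzOnWith_of_nnnorm_hasDerivWithin_le
      (fun t ht => (hγ t ht).hasDerivWithinAt) (fun t ht => hM _)
  obtain ⟨u, -, hu, hus⟩ := exists_seq_strictMono_tendsto' (show -e < s by linarith)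
  have hcs : CauchySeq (fun n => γ (u n)) := by
    rw [Metric.cauchySeq_iff']
    intro η hη
    obtain ⟨N, hN⟩ := Metric.cauchySeq_iff'.1 hus.cauchySeq (η / (M + 1)) (by positivity)
    refine ⟨N, fun n hn => ?_⟩
    have h1 := hLip.dist_le_mul _ (hu n) _ (hu N)
    have h2 := hN n hn
    rw [lt_div_iff₀ (by positivity)] at h2
    have h3 : dist (γ (u n)) (γ (u N)) ≤ M * dist (u n) (u N) := h1
    nlinarith [dist_nonneg (x := u n) (y := u N), dist_nonneg (x := γ (u n)) (y := γ (u N))]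
  obtain ⟨p, hp⟩ := cauchySeq_tendsto_of_complete hcs
  obtain ⟨r', hr', e', he', β, hβ, -⟩ := ode_box hf hM p
  obtain ⟨n, hn1, hn2, hn3⟩ := ((hp.eventually (closedBall_mem_nhds p hr')).and
    ((hus.eventually (lt_mem_nhds (show s - e' < s by linarith))).and
     (hus.eventually (lt_mem_nhds (show e' - e' - e < s by linarith))))).exists
  obtain ⟨hb0, hb⟩ := hβ _ hn1
  have hsol : ∀ t ∈ Ioo (max (-e) (u n - e')) (u n + e'),
      HasDerivAt (fun t => β (γ (u n)) (t - u n)) (f (β (γ (u n)) (t - u n))) t := by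
    intro t ht
    have h1 := (le_max_right _ _).trans_lt ht.1
    exact (hb (t - u n) ⟨by linarith, by linarith [ht.2]⟩).comp_sub_const t (u n)
  obtain ⟨γ', he1, hγ'⟩ := ode_glue hf (hu n) (t₀ := u n) (c := max (-e) (u n - e'))
    ⟨max_lt (hu n).1 (by linarith), by linarith⟩ (le_max_left _ _) hγ hsol (by simp [hb0])
  have : u n + e' ∈ R := ⟨γ', by rw [he1 ⟨by linarith, by linarith⟩, h0], hγ'⟩
  have := le_csSup ⟨T, hTR⟩ this
  linarith

theorem ode_global {X : Type*} [NormedAddCommGroup X] [NormedSpace ℝ X] [CompleteSpace X] {f : X → X}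
    (hf : LocallyLipschitz f) {M : ℝ} (hM : ∀ x, ‖f x‖ ≤ M) (x : X) :
    ∃ γ : ℝ → X, γ 0 = x ∧ ∀ t, HasDerivAt γ (f (γ t)) t := by
  obtain ⟨a, ha, h⟩ := ode_forward hf hM x
  obtain ⟨a', ha', h'⟩ := ode_forward (f := fun x => - f x) hf.neg (M := M) (by simpa using hM) x
  have key : ∀ T > 0, ∃ γ : ℝ → X, γ 0 = x ∧ ∀ t ∈ Ioo (-T) T, HasDerivAt γ (f (γ t)) t := by
    intro T hT
    obtain ⟨γ, h0, hγ⟩ := h T hT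
    obtain ⟨γ', h0', hγ'⟩ := h' (max T (-a)) (by positivity)
    have hs : ∀ t ∈ Ioo (-(max T (-a))) (-a'), HasDerivAt (fun t => γ' (-t)) (f (γ' (-t))) t := by
      intro t ht
      have := (hγ' (-t) ⟨by linarith [ht.2], by linarith [ht.1]⟩).scomp t (hasDerivAt_neg t)
      rw [neg_smul, one_smul, neg_neg] at this
      exact this
    obtain ⟨g, hg, hg'⟩ := ode_glue hf (t₀ := 0) (a := -(max T (-a)))
      ⟨by simp [hT], by linarith⟩ ⟨ha, hT⟩ (by linarith [le_max_right T (-a)]) hs hγ (by simp [h0, h0'])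
    refine ⟨g, ?_, fun t ht => hg' t ⟨?_, ht.2⟩⟩
    · rw [hg ⟨by simp [hT], by linarith⟩]; simp [h0']
    · linarith [le_max_left T (-a), ht.1]
  choose! γ h0 hγ using key
  refine ⟨fun t => γ (|t| + 1) t, h0 _ (by positivity), fun t => ?_⟩
  have e : (fun t => γ (|t| + 1) t) =ᶠ[nhds t] γ (|t| + 1) := by
    filter_upwards [isOpen_Ioo.mem_nhds
      (show t ∈ Ioo (-(|t| + 1)) (|t| + 1) from ⟨by linarith [neg_abs_le t], by linarith [le_abs_self t]⟩)]
      with s hs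
    have hp : 0 < min (|s| + 1) (|t| + 1) := by positivity
    refine ode_uniq hf (a := -(min (|s| + 1) (|t| + 1))) (b := min (|s| + 1) (|t| + 1)) (t₀ := 0)
      ⟨by linarith, hp⟩
      (fun u hu => hγ _ (by positivity) u ?_) (fun u hu => hγ _ (by positivity) u ?_)
      ((h0 _ (by positivity)).trans (h0 _ (by positivity)).symm) ?_
    · exact ⟨by linarith [hu.1, min_le_left (|s| + 1) (|t| + 1)], hu.2.trans_le (min_le_left _ _)⟩
    · exact ⟨by linarith [hu.1, min_le_right (|s| + 1) (|t| + 1)], hu.2.trans_le (min_le_right _ _)⟩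
    · have : |s| < min (|s| + 1) (|t| + 1) := lt_min (by linarith) (abs_lt.2 hs)
      exact abs_lt.1 this
  exact (hγ _ (by positivity) t ⟨by linarith [neg_abs_le t], by linarith [le_abs_self t]⟩).congr_of_eventuallyEq e

open Topology in
theorem ode_flow {X : Type*} [NormedAddCommGroup X] [NormedSpace ℝ X] [CompleteSpace X] {f : X → X}
    (hf : LocallyLipschitz f) {M : ℝ} (hM : ∀ x, ‖f x‖ ≤ M) :
    ∃ σ : ℝ → X → X, (∀ x, σ 0 x = x) ∧ (∀ x t, HasDerivAt (fun t => σ t x) (f (σ t x)) t) ∧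
      (∀ s t x, σ s (σ t x) = σ (s + t) x) ∧ (∀ s t x, ‖σ s x - σ t x‖ ≤ M * |s - t|) ∧
      (∀ x, f x = 0 → ∀ t, σ t x = x) ∧
      Continuous (fun p : ℝ × X => σ p.1 p.2) := by
  choose σ' h0 hσ using ode_global hf hM
  have uniq : ∀ (γ₁ γ₂ : ℝ → X), (∀ t, HasDerivAt γ₁ (f (γ₁ t)) t) →
      (∀ t, HasDerivAt γ₂ (f (γ₂ t)) t) → γ₁ 0 = γ₂ 0 → ∀ t, γ₁ t = γ₂ t := by
    intro γ₁ γ₂ h1 h2 h t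
    exact ode_uniq hf (a := -(|t| + 1)) (b := |t| + 1) (t₀ := 0)
      ⟨by linarith [abs_nonneg t], by positivity⟩ (fun t _ => h1 t) (fun t _ => h2 t) h
      ⟨by linarith [neg_abs_le t], by linarith [le_abs_self t]⟩
  have hM0 : ∀ x : X, 0 ≤ M := fun x => (norm_nonneg _).trans (hM x)
  have hsemi : ∀ s t x, σ' (σ' x t) s = σ' x (s + t) := by
    intro s t x
    refine uniq (σ' (σ' x t)) (fun s => σ' x (s + t)) (hσ _) (fun s => ?_) (by simp [h0]) s
    exact (hσ x (s + t)).comp_add_const s t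
  have hlip : ∀ s t x, ‖σ' x s - σ' x t‖ ≤ M * |s - t| := by
    intro s t x
    have := convex_univ.norm_image_sub_le_of_norm_hasDerivWithin_le (f := σ' x) (C := M)
      (fun t _ => (hσ x t).hasDerivWithinAt) (fun t _ => hM _) (mem_univ t) (mem_univ s)
    simpa using this
  refine ⟨fun t x => σ' x t, h0, hσ, hsemi, hlip, ?_, ?_⟩
  · intro x hx t
    refine uniq (σ' x) (fun _ => x) (hσ x) (fun t => ?_) (h0 x) t
    rw [hx]; exact hasDerivAt_const t x
  have hcont : ∀ t, Continuous (fun x => σ' x t) := by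
    intro t
    rw [continuous_iff_continuousAt]
    intro x
    -- local all-or-none property
    have loc : ∀ t₀ : ℝ, ∃ d > 0, ∀ t ∈ ball t₀ d, ∀ t' ∈ ball t₀ d,
        ContinuousAt (fun x => σ' x t) x → ContinuousAt (fun x => σ' x t') x := by
      intro t₀
      obtain ⟨r, hr, e, he, α, hα, hαc⟩ := ode_box hf hM (σ' x t₀)
      have hnh : ∀ᶠ t in 𝓝 t₀, σ' x t ∈ ball (σ' x t₀) r :=
        (hσ x t₀).continuousAt (ball_mem_nhds _ hr)
      obtain ⟨d, hd, hdb⟩ := Metric.eventually_nhds_iff_ball.1 hnh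
      refine ⟨min d (e / 2), by positivity, fun t ht t' ht' hct => ?_⟩
      have hb := hdb t (ball_subset_ball (min_le_left _ _) ht)
      have h1 := ball_subset_ball (min_le_right d (e/2)) ht
      have h2 := ball_subset_ball (min_le_right d (e/2)) ht'
      rw [Real.ball_eq_Ioo] at h1 h2
      have hte : t' - t ∈ Ioo (-e) e := ⟨by linarith [h1.2, h2.1], by linarith [h1.1, h2.2]⟩
      have heq : ∀ y ∈ closedBall (σ' x t₀) r, α y (t' - t) = σ' y (t' - t) := by
        intro y hy
        exact ode_uniq hf (t₀ := 0) ⟨by linarith, he⟩ (hα y hy).2 (fun t _ => hσ y t)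
          ((hα y hy).1.trans (h0 y).symm) hte
      have c1 : ContinuousAt (fun y => σ' y (t' - t)) (σ' x t) := by
        have hn : closedBall (σ' x t₀) r ∈ 𝓝 (σ' x t) :=
          mem_of_superset (isOpen_ball.mem_nhds hb) ball_subset_closedBall
        refine ((hαc _ hte).continuousAt hn).congr ?_
        filter_upwards [hn] with y hy using heq y hy
      have c2 : ContinuousAt (fun x => σ' (σ' x t) (t' - t)) x :=
        ContinuousAt.comp (g := fun y => σ' y (t' - t)) (f := fun x => σ' x t) c1 hct
      have : (fun x => σ' (σ' x t) (t' - t)) = fun x => σ' x t' := by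
        ext y; rw [hsemi]; simp
      rwa [this] at c2
    have hclopen : IsClopen {t | ContinuousAt (fun x => σ' x t) x} := by
      constructor
      · rw [← isOpen_compl_iff, Metric.isOpen_iff]
        intro t ht
        obtain ⟨d, hd, h⟩ := loc t
        exact ⟨d, hd, fun t' ht' hc => ht (h t' ht' t (mem_ball_self hd) hc)⟩
      · rw [Metric.isOpen_iff]
        intro t ht
        obtain ⟨d, hd, h⟩ := loc t
        exact ⟨d, hd, fun t' ht' => h t (mem_ball_self hd) t' ht' ht⟩
    have := hclopen.eq_univ ⟨0, by simp only [mem_setOf_eq, h0]; exact continuousAt_id⟩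
    exact (this ▸ mem_univ t : t ∈ {t | ContinuousAt (fun x => σ' x t) x})
  refine continuous_prod_of_continuous_lipschitzWith (fun p : ℝ × X => σ' p.2 p.1) (M.toNNReal)
    hcont ?_
  intro x
  refine LipschitzWith.of_dist_le_mul fun s t => ?_
  rw [dist_eq_norm, Real.dist_eq, Real.coe_toNNReal _ (hM0 x)]
  exact hlip s t x

open Topology in
theorem lip_selection {X : Type*} [NormedAddCommGroup X] [NormedSpace ℝ X] (C : X → Set X)
    (hC : ∀ x, Convex ℝ (C x)) (hloc : ∀ x, ∃ w, ∀ᶠ y in 𝓝 x, w ∈ C y) :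
    ∃ W : X → X, LocallyLipschitz W ∧ ∀ x, W x ∈ C x := by
  classical
  choose w hw using hloc
  choose U hUw hUo hxU using fun x => _root_.eventually_nhds_iff.1 (hw x)
  obtain ⟨V, hVo, hVc, hVf, hVU⟩ := precise_refinement U hUo
    (iUnion_eq_univ_iff.2 fun x => ⟨x, hxU x⟩)
  let ρ : X → X → ℝ := fun i y => if V i = univ then 1 else infDist y (V i)ᶜ
  have hρ0 : ∀ i y, 0 ≤ ρ i y := by
    intro i y; dsimp [ρ]; split_ifs
    · norm_num
    · exact infDist_nonneg
  have hρne : ∀ i y, ρ i y ≠ 0 → y ∈ V i := by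
    intro i y h
    by_contra hy
    apply h
    dsimp [ρ]
    rw [if_neg (fun h : V i = univ => hy (by rw [h]; exact mem_univ y))]
    exact infDist_zero_of_mem hy
  have hρpos : ∀ i y, y ∈ V i → 0 < ρ i y := by
    intro i y hy
    dsimp [ρ]
    split_ifs with h
    · norm_num
    · refine ((hVo i).isClosed_compl.notMem_iff_infDist_pos ?_).1 (by simpa using hy)
      exact nonempty_compl.2 h
  have hρL : ∀ i, LipschitzWith 1 (ρ i) := by
    intro i
    dsimp [ρ]
    split_ifs with h
    · exact LipschitzWith.const' 1
    · exact lipschitz_infDist_pt _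
  -- local structure
  have hlocal : ∀ x, ∃ N ∈ 𝓝 x, ∃ F : Finset X, ∀ y ∈ N, ∀ i, ρ i y ≠ 0 → i ∈ F := by
    intro x
    obtain ⟨N, hN, hfin⟩ := hVf x
    exact ⟨N, hN, hfin.toFinset, fun y hy i hi => by
      simpa using ⟨y, hρne i y hi, hy⟩⟩
  have hsum : ∀ (F : Finset X) y, (∀ i, ρ i y ≠ 0 → i ∈ F) → 0 < ∑ i ∈ F, ρ i y := by
    intro F y hF
    obtain ⟨i, hi⟩ := iUnion_eq_univ_iff.1 hVc y
    have := hρpos i y hi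
    exact Finset.sum_pos' (fun i _ => hρ0 i y) ⟨i, hF i this.ne', this⟩
  let W : X → X := fun y => ∑ᶠ i, (ρ i y / ∑ᶠ j, ρ j y) • w i
  have hden : ∀ (F : Finset X) y, (∀ i, ρ i y ≠ 0 → i ∈ F) → ∑ᶠ j, ρ j y = ∑ i ∈ F, ρ i y := by
    intro F y hF
    exact finsum_eq_sum_of_support_subset _ (fun i hi => hF i hi)
  refine ⟨W, ?_, ?_⟩
  · intro x
    obtain ⟨N, hN, F, hF⟩ := hlocal x
    let g : X → (F → ℝ) := fun y i => ρ i y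
    have hg : LipschitzWith 1 g := by
      refine LipschitzWith.of_edist_le fun y z => ?_
      rw [edist_pi_le_iff]
      intro i
      simpa using hρL i y z
    let Φ : (F → ℝ) → X := fun z => ∑ i : F, (z i / ∑ j : F, z j) • w i
    have hW : ∀ y ∈ N, W y = Φ (g y) := by
      intro y hy
      simp only [W, Φ, g]
      rw [hden F y (hF y hy), Finset.sum_coe_sort F (fun i => ρ i y),
        Finset.sum_coe_sort F (fun i => (ρ i y / ∑ j ∈ F, ρ j y) • w i)]
      refine finsum_eq_sum_of_support_subset _ (fun i hi => hF y hy i ?_)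
      intro h
      simp [h] at hi
    have hxN := mem_of_mem_nhds hN
    have hΦ : ContDiffAt ℝ 1 Φ (g x) := by
      have hne : ∑ j : F, g x j ≠ 0 := by
        have := (hsum F x (hF x hxN)).ne'
        rwa [← Finset.sum_coe_sort] at this
      refine ContDiffAt.sum fun i _ => ?_
      refine ContDiffAt.smul ?_ contDiffAt_const
      refine ContDiffAt.div (by fun_prop) (by fun_prop) hne
    obtain ⟨K, t, ht, hK⟩ := hΦ.exists_lipschitzOnWith
    refine ⟨K * 1, N ∩ g ⁻¹' t, inter_mem hN (hg.continuous.continuousAt ht), ?_⟩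
    have : LipschitzOnWith (K * 1) (Φ ∘ g) (N ∩ g ⁻¹' t) :=
      hK.comp hg.lipschitzOnWith (fun y hy => hy.2)
    intro y hy z hz
    rw [hW y hy.1, hW z hz.1]
    exact this hy hz
  · intro x
    obtain ⟨N, hN, F, hF⟩ := hlocal x
    have hF := hF x (mem_of_mem_nhds hN)
    have hp := hsum F x hF
    refine (hC x).finsum_mem (fun i => div_nonneg (hρ0 i x) ?_) ?_ ?_
    · rw [hden F x hF]; exact hp.le
    · rw [hden F x hF, finsum_eq_sum_of_support_subset (s := F), ← Finset.sum_div, div_self hp.ne']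
      intro i hi
      apply hF
      intro h; simp [h] at hi
    · intro i hi
      have : x ∈ V i := hρne i x (fun h => by simp [h] at hi)
      exact hUw i x (hVU i this)

open Topology in
/-- The normalized pseudo-gradient field. -/
theorem pseudo_gradient {X : Type*} [NormedAddCommGroup X] [NormedSpace ℝ X]
    (φ : X → ℝ) (hφ : ContDiff ℝ 1 φ) (A : Set X) (hA : IsClosed A) (k : ℝ) (hk : 0 < k)
    (hgrad : ∀ u ∈ A, k ≤ ‖fderiv ℝ φ u‖) :
    ∃ W : X → X, LocallyLipschitz W ∧ (∀ u, ‖W u‖ ≤ 1 / k) ∧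
      ∀ u ∈ A, fderiv ℝ φ u (W u) ≤ -(1 / 4) := by
  have hcd : Continuous (fderiv ℝ φ) := hφ.continuous_fderiv (by norm_num)
  obtain ⟨W, hW, hWC⟩ := lip_selection
    (fun u => closedBall (0:X) (1 / k) ∩ {w | u ∈ A → fderiv ℝ φ u w ≤ -(1 / 4)}) (by
      intro u
      refine (convex_closedBall _ _).inter ?_
      by_cases hu : u ∈ A
      · simp only [hu, true_imp_iff]
        exact convex_halfSpace_le (fderiv ℝ φ u).isLinear _
      · simp only [hu, false_imp_iff, setOf_true]
        exact convex_univ) (by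
      intro u
      by_cases hu : u ∈ A
      · have hn := hgrad u hu
        obtain ⟨v, hv1, hv2⟩ := (fderiv ℝ φ u).exists_lt_apply_of_lt_opNorm
          (r := k / 2) (by linarith)
        rw [Real.norm_eq_abs] at hv2
        obtain ⟨v', hv1', hv2'⟩ : ∃ v' : X, ‖v'‖ < 1 ∧ fderiv ℝ φ u v' < -(k / 2) := by
          rcases lt_abs.1 hv2 with h | h
          · exact ⟨-v, by simpa using hv1, by rw [map_neg]; linarith⟩
          · exact ⟨v, hv1, by linarith⟩
        refine ⟨(1 / k) • v', ?_⟩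
        have hlt : fderiv ℝ φ u ((1 / k) • v') < -(1 / 4) := by
          rw [map_smul, smul_eq_mul, one_div_mul_eq_div, div_lt_iff₀ hk]
          linarith
        have hc : Continuous (fun y => fderiv ℝ φ y ((1 / k) • v')) := hcd.clm_apply continuous_const
        filter_upwards [hc.continuousAt.eventually (gt_mem_nhds hlt)] with y hy
        refine ⟨?_, fun _ => le_of_lt hy⟩
        rw [mem_closedBall_zero_iff, norm_smul, Real.norm_of_nonneg (by positivity)]
        have : 0 < 1 / k := by positivity
        nlinarith
      · refine ⟨0, ?_⟩
        filter_upwards [hA.isOpen_compl.mem_nhds hu] with y hy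
        exact ⟨by simp [hk.le], fun h => absurd h hy⟩)
  exact ⟨W, hW, fun u => by simpa using (hWC u).1, fun u hu => (hWC u).2 hu⟩

theorem stmt_18 {X : Type*} [NormedAddCommGroup X] [NormedSpace ℝ X] [CompleteSpace X]
    (φ : X → ℝ) (hφ : ContDiff ℝ 1 φ) (S : Set X) (c ε δ : ℝ)
    (hε : 0 < ε) (hδ : 0 < δ)
    (hgrad : ∀ u : X, φ u ∈ Set.Icc (c - 2 * ε) (c + 2 * ε) →
      Metric.infDist u S ≤ 2 * δ → 8 * ε / δ ≤ ‖fderiv ℝ φ u‖) :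
    ∃ η : ℝ → X → X,
      -- η ∈ C([0,1] × X, X)
      ContinuousOn (fun p : ℝ × X => η p.1 p.2) (Set.Icc 0 1 ×ˢ Set.univ) ∧
      -- (i) η(t,u) = u if t = 0 or u ∉ φ⁻¹([c−2ε,c+2ε]) ∩ S_{2δ}
      (∀ t ∈ Set.Icc (0:ℝ) 1, ∀ u : X,
        (t = 0 ∨ ¬ (φ u ∈ Set.Icc (c - 2 * ε) (c + 2 * ε) ∧ Metric.infDist u S ≤ 2 * δ)) →
          η t u = u) ∧
      -- (ii) η(1, φ^{c+ε} ∩ S) ⊂ φ^{c−ε}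
      (∀ u ∈ S, φ u ≤ c + ε → φ (η 1 u) ≤ c - ε) ∧
      -- (iii) η(t,·) is a homeomorphism of X for each t ∈ [0,1]
      (∀ t ∈ Set.Icc (0:ℝ) 1, ∃ e : X ≃ₜ X, ∀ u, e u = η t u) ∧
      -- (iv) ‖η(t,u) − u‖ ≤ δ
      (∀ t ∈ Set.Icc (0:ℝ) 1, ∀ u : X, ‖η t u - u‖ ≤ δ) ∧
      -- (v) t ↦ φ(η(t,u)) is non-increasing
      (∀ u : X, AntitoneOn (fun t => φ (η t u)) (Set.Icc 0 1)) ∧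
      -- (vi) φ(η(t,u)) < c for u ∈ φᶜ ∩ S_δ and t ∈ (0,1]
      (∀ u : X, φ u ≤ c → Metric.infDist u S ≤ δ →
        ∀ t ∈ Set.Ioc (0:ℝ) 1, φ (η t u) < c) := by
  have hφc := hφ.continuous
  let A : Set X := {u | φ u ∈ Set.Icc (c - 2 * ε) (c + 2 * ε) ∧ Metric.infDist u S ≤ 2 * δ}
  have hA : IsClosed A :=
    (isClosed_Icc.preimage hφc).inter (isClosed_le (continuous_infDist_pt S) continuous_const)
  obtain ⟨W, hWL, hWn, hWA⟩ := pseudo_gradient φ hφ A hA (8 * ε / δ) (by positivity)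
    (fun u hu => hgrad u hu.1 hu.2)
  have hM : 1 / (8 * ε / δ) = δ / (8 * ε) := by rw [one_div_div]
  rw [hM] at hWn
  -- cutoff functions
  let ψ : X → ℝ := fun u => max 0 (min 1 (min (2 - infDist u S / δ)
    (min (2 - (φ u - c) / ε) (2 - (c - φ u) / ε))))
  have hφL : LocallyLipschitz φ := hφ.locallyLipschitz
  have aff : ∀ (a b : ℝ) (g : X → ℝ), LocallyLipschitz g → LocallyLipschitz (fun u => a + b * g u) := by
    intro a b g hg
    have h1 : LocallyLipschitz (fun x : ℝ => a + b * x) :=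
      ContDiff.locallyLipschitz (𝕂 := ℝ) (by fun_prop)
    exact h1.comp hg
  have hψL : LocallyLipschitz ψ := by
    have hd : LocallyLipschitz (fun u => infDist u S) := (lipschitz_infDist_pt S).locallyLipschitz
    have e1 : LocallyLipschitz (fun u => 2 - infDist u S / δ) := by
      convert aff 2 (-1 / δ) _ hd using 2; ring
    have e2 : LocallyLipschitz (fun u => 2 - (φ u - c) / ε) := by
      convert aff (2 + c / ε) (-1 / ε) _ hφL using 2; ring
    have e3 : LocallyLipschitz (fun u => 2 - (c - φ u) / ε) := by
      convert aff (2 - c / ε) (1 / ε) _ hφL using 2; ring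
    exact ((e1.min (e2.min e3)).const_min 1).const_max 0
  have hψ0 : ∀ u, 0 ≤ ψ u := fun u => le_max_left _ _
  have hψ1 : ∀ u, ψ u ≤ 1 := fun u => max_le zero_le_one (min_le_left _ _)
  have hψA : ∀ u, ψ u ≠ 0 → u ∈ A := by
    intro u h
    have hpos : 0 < ψ u := lt_of_le_of_ne (hψ0 u) (Ne.symm h)
    simp only [ψ, lt_max_iff, lt_irrefl, false_or, lt_min_iff, sub_pos] at hpos
    obtain ⟨-, h1, h2, h3⟩ := hpos
    rw [div_lt_iff₀ hδ] at h1
    rw [div_lt_iff₀ hε] at h2 h3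
    exact ⟨⟨by linarith, by linarith⟩, h1.le⟩
  have hψB : ∀ u, φ u ∈ Icc (c - ε) (c + ε) → infDist u S ≤ δ → ψ u = 1 := by
    intro u h1 h2
    refine le_antisymm (hψ1 u) (le_max_of_le_right ?_)
    have a1 : infDist u S / δ ≤ 1 := (div_le_one hδ).2 h2
    have a2 : (φ u - c) / ε ≤ 1 := (div_le_one hε).2 (by linarith [h1.2])
    have a3 : (c - φ u) / ε ≤ 1 := (div_le_one hε).2 (by linarith [h1.1])
    refine le_min le_rfl (le_min ?_ (le_min ?_ ?_)) <;> linarith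
  let f : X → X := fun u => ψ u • W u
  have hfL : LocallyLipschitz f := by
    have h1 : LocallyLipschitz (fun p : ℝ × X => p.1 • p.2) :=
      ContDiff.locallyLipschitz (𝕂 := ℝ) (by fun_prop)
    exact h1.comp (hψL.prodMk hWL)
  have hfM : ∀ u, ‖f u‖ ≤ δ / (8 * ε) := by
    intro u
    simp only [f]
    rw [norm_smul, Real.norm_of_nonneg (hψ0 u)]
    calc ψ u * ‖W u‖ ≤ 1 * ‖W u‖ := by gcongr; exact hψ1 u
      _ ≤ _ := by rw [one_mul]; exact hWn u
  have hfd : ∀ u, fderiv ℝ φ u (f u) ≤ -(1 / 4) * ψ u := by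
    intro u
    simp only [f]
    rw [map_smul, smul_eq_mul]
    by_cases h : ψ u = 0
    · simp [h]
    · nlinarith [hWA u (hψA u h), hψ0 u]
  obtain ⟨σ, hσ0, hσd, hσs, hσn, hσf, hσc⟩ := ode_flow hfL hfM
  have hcd : ∀ u t, HasDerivAt (fun t => φ (σ t u)) (fderiv ℝ φ (σ t u) (f (σ t u))) t := by
    intro u t
    exact ((hφ.differentiable (by norm_num)) (σ t u)).hasFDerivAt.comp_hasDerivAt t (hσd u t)
  have hanti : ∀ u, Antitone (fun t => φ (σ t u)) := by
    intro u
    refine antitone_of_hasDerivAt_nonpos (hcd u) (fun t => ?_)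
    have h1 := hfd (σ t u)
    have h2 := hψ0 (σ t u)
    show fderiv ℝ φ (σ t u) (f (σ t u)) ≤ 0
    linarith
  have hdisp : ∀ t ∈ Icc (0:ℝ) 1, ∀ u, ‖σ (8 * ε * t) u - u‖ ≤ δ := by
    intro t ht u
    have := hσn (8 * ε * t) 0 u
    rw [hσ0, sub_zero, abs_of_nonneg (by have := ht.1; positivity)] at this
    have e : δ / (8 * ε) * (8 * ε * t) = δ * t := by field_simp
    rw [e] at this
    nlinarith [ht.2]
  refine ⟨fun t u => σ (8 * ε * t) u, ?_, ?_, ?_, ?_, hdisp, ?_, ?_⟩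
  · have : Continuous (fun p : ℝ × X => σ (8 * ε * p.1) p.2) :=
      hσc.comp (f := fun p : ℝ × X => (8 * ε * p.1, p.2)) (by fun_prop)
    exact this.continuousOn
  · rintro t - u (rfl | h)
    · simp [hσ0]
    · apply hσf
      have : ψ u = 0 := by
        by_contra h'
        exact h (hψA u h')
      simp [f, this]
  · intro u hu huc
    by_contra! hcon
    have hin : ∀ t ∈ Icc 0 (8 * ε), ψ (σ t u) = 1 := by
      intro t ht
      apply hψB
      · constructor
        · have := hanti u ht.2
          simp only [mul_one] at hcon this
          linarith
        · have := hanti u ht.1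
          simp only [hσ0] at this
          linarith
      · have h1 : infDist (σ t u) S ≤ dist (σ t u) u := infDist_le_dist_of_mem hu
        have h2 := hdisp (t / (8 * ε)) ⟨by have := ht.1; positivity,
          (div_le_one (by positivity)).2 ht.2⟩ u
        have e : 8 * ε * (t / (8 * ε)) = t := by field_simp
        rw [e, ← dist_eq_norm] at h2
        linarith
    have hmv := (convex_Icc (0:ℝ) (8 * ε)).image_sub_le_mul_sub_of_deriv_le
      (f := fun t => φ (σ t u)) (C := -(1 / 4))
      (fun t _ => (hcd u t).continuousAt.continuousWithinAt)
      (fun t _ => (hcd u t).differentiableAt.differentiableWithinAt)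
      (fun t ht => by
        rw [(hcd u t).deriv]
        have := hfd (σ t u)
        rw [hin t (interior_subset ht)] at this
        linarith)
      0 ⟨le_rfl, by positivity⟩ (8 * ε) ⟨by positivity, le_rfl⟩ (by positivity)
    simp only [hσ0, mul_one] at hmv hcon
    linarith
  · intro t _
    have hc : ∀ s, Continuous (σ s) := fun s => hσc.comp (f := fun x => (s, x)) (by fun_prop)
    exact ⟨{ toFun := σ (8 * ε * t)
             invFun := σ (-(8 * ε * t))
             left_inv := fun u => by rw [hσs]; simp [hσ0]
             right_inv := fun u => by rw [hσs]; simp [hσ0]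
             continuous_toFun := hc _
             continuous_invFun := hc _ }, fun u => rfl⟩
  · intro u s _ t _ hst
    exact hanti u (by gcongr)
  · intro u hu hd t ht
    have hT : 0 < 8 * ε * t := by have := ht.1; positivity
    by_contra! hcon
    have hle := hanti u hT.le
    simp only [hσ0] at hle hcon
    have hu' : φ u = c := by linarith
    have h1 : ψ u = 1 := hψB u ⟨by linarith, by linarith⟩ hd
    have hder := (hcd u 0).hasDerivWithinAt (s := Icc 0 (8 * ε * t))
    have hcst : HasDerivWithinAt (fun t => φ (σ t u)) 0 (Icc 0 (8 * ε * t)) 0 := by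
      refine (hasDerivWithinAt_const (0:ℝ) (Icc 0 (8 * ε * t)) c).congr ?_ (by simp [hσ0, hu'])
      intro s hs
      have a1 := hanti u hs.1
      have a2 := hanti u hs.2
      simp only [hσ0] at a1 a2
      linarith
    have heq := (uniqueDiffOn_Icc hT 0 ⟨le_rfl, hT.le⟩).eq_deriv _ hder hcst
    have := hfd (σ 0 u)
    rw [heq, hσ0, h1] at this
    linarith
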